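/- arXiv:1112.3677 — 3 statements merged into one kernel-verified Lean document; each statement's English description precedes it below -/
import Mathlib

section
/- Let f : ℝ × ℝ × ℝ → ℝ be differentiable and, for each fixed t, positively homogeneous of degree 1 in its first two arguments (f(cK, cL, t) = c·f(K, L, t) for all c > 0, K, L > 0). Let K, L : ℝ → ℝ be differentiable with K(t), L(t) > 0, let n, g be constants with L'(t) = n·L(t) for all t, and set Y(t) = f(K(t), L(t), t) with Y(t) > 0. If Y'(t)/Y(t) = g and K'(t)/K(t) = g for all t (steady state), then for all t: ∂₃f(K(t), L(t), t) = (g − n)·L(t)·∂₂f(K(t), L(t), t). -/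
/-- Euler's identity at a point where a function is homogeneous of degree one in its first two
arguments. -/
theorem fderiv_apply_eq_of_homogeneous {f : ℝ × ℝ × ℝ → ℝ} {x y t : ℝ}
    (hf : DifferentiableAt ℝ f (x, y, t))
    (hhom : ∀ c > (0 : ℝ), f (c * x, c * y, t) = c * f (x, y, t)) :
    fderiv ℝ f (x, y, t) (x, y, 0) = f (x, y, t) := by
  have hline : HasDerivAt (fun c : ℝ => (c * x, c * y, t)) (x, y, 0) 1 := by
    simpa using ((hasDerivAt_id (1 : ℝ)).mul_const x).prodMk
      (((hasDerivAt_id (1 : ℝ)).mul_const y).prodMk (hasDerivAt_const (1 : ℝ) t))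
  have hcomp : HasDerivAt (fun c : ℝ => f (c * x, c * y, t)) (fderiv ℝ f (x, y, t) (x, y, 0)) 1 :=
    hf.hasFDerivAt.comp_hasDerivAt_of_eq 1 hline (by simp)
  have hlin : HasDerivAt (fun c : ℝ => c * f (x, y, t)) (f (x, y, t)) 1 := by
    simpa using (hasDerivAt_id (1 : ℝ)).mul_const (f (x, y, t))
  refine hcomp.unique (hlin.congr_of_eventuallyEq ?_)
  filter_upwards [lt_mem_nhds (zero_lt_one' ℝ)] with c hc using hhom c hc

/-- The paper's Theorem: in a Solow/Swan steady state, the production function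
satisfies the advective equation f_t = (g - n) · L · f_L along the path. -/
theorem steady_state_advective_equation
    (f : ℝ × ℝ × ℝ → ℝ) (hf : Differentiable ℝ f)
    (hhom : ∀ t : ℝ, ∀ c > (0:ℝ), ∀ K L : ℝ, 0 < K → 0 < L →
      f (c * K, c * L, t) = c * f (K, L, t))
    (K L : ℝ → ℝ) (hK : Differentiable ℝ K) (hL : Differentiable ℝ L)
    (hKpos : ∀ t, 0 < K t) (hLpos : ∀ t, 0 < L t)
    (n g : ℝ) (hLgrow : ∀ t, deriv L t = n * L t)
    (Y : ℝ → ℝ) (hY : ∀ t, Y t = f (K t, L t, t)) (hYpos : ∀ t, 0 < Y t)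
    (hYg : ∀ t, deriv Y t / Y t = g) (hKg : ∀ t, deriv K t / K t = g) :
    ∀ t, deriv (fun s => f (K t, L t, s)) t
        = (g - n) * L t * deriv (fun y => f (K t, y, t)) (L t) := by
  intro t
  have hfd := (hf (K t, L t, t)).hasFDerivAt
  set D := fderiv ℝ f (K t, L t, t) with hD
  have hdt : deriv (fun s => f (K t, L t, s)) t = D (0, 0, 1) :=
    (hfd.comp_hasDerivAt t ((hasDerivAt_const t (K t)).prodMk
      ((hasDerivAt_const t (L t)).prodMk (hasDerivAt_id t)))).deriv
  have hdL : deriv (fun y => f (K t, y, t)) (L t) = D (0, 1, 0) :=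
    (hfd.comp_hasDerivAt (L t) ((hasDerivAt_const (L t) (K t)).prodMk
      ((hasDerivAt_id (L t)).prodMk (hasDerivAt_const (L t) t)))).deriv
  have hdY : deriv Y t = D (deriv K t, deriv L t, 1) := by
    rw [funext hY]
    exact (hfd.comp_hasDerivAt t ((hK t).hasDerivAt.prodMk
      ((hL t).hasDerivAt.prodMk (hasDerivAt_id t)))).deriv
  have heuler : D (K t, L t, 0) = f (K t, L t, t) :=
    fderiv_apply_eq_of_homogeneous (hf _)
      fun c hc => hhom t c hc (K t) (L t) (hKpos t) (hLpos t)
  have hYt : deriv Y t = g * Y t := (div_eq_iff (hYpos t).ne').mp (hYg t)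
  have hKt : deriv K t = g * K t := (div_eq_iff (hKpos t).ne').mp (hKg t)
  have hdecomp : ((deriv K t, deriv L t, 1) : ℝ × ℝ × ℝ)
      = g • (K t, L t, 0) + ((n - g) * L t) • (0, 1, 0) + (0, 0, 1) := by
    ext <;> simp [hKt, hLgrow t]
    ring
  rw [hYt, hY t, hdecomp, map_add, map_add, map_smul, map_smul, heuler] at hdY
  simp only [smul_eq_mul] at hdY
  rw [hdt, hdL]
  linarith
end

section
/- Let f : ℝ × ℝ × ℝ → ℝ be differentiable, let ρ be a constant, and suppose that ∂₃f(K, L, t) = ρ·L·∂₂f(K, L, t) for all K, L, t. Then there exists a function F : ℝ × ℝ → ℝ such that f(K, L, t) = F(K, L·exp(ρ·t)) for all K, L, t; indeed F(K, x) = f(K, x, 0) works. -/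
/-- Solutions of the advective equation f_t = ρ·L·f_L have the Harrod
(labor-augmenting) form f(K, L, t) = F(K, L·exp(ρ·t)). -/
theorem advective_solution_harrod_form
    (f : ℝ × ℝ × ℝ → ℝ) (hf : Differentiable ℝ f) (ρ : ℝ)
    (hpde : ∀ K L t : ℝ, deriv (fun s => f (K, L, s)) t
        = ρ * L * deriv (fun y => f (K, y, t)) L) :
    ∃ F : ℝ × ℝ → ℝ, (∀ K L t : ℝ, f (K, L, t) = F (K, L * Real.exp (ρ * t)))
      ∧ ∀ K x : ℝ, F (K, x) = f (K, x, 0) := by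
  refine ⟨fun p => f (p.1, p.2, 0), fun K L t => ?_, fun K x => rfl⟩
  have hchar : ∀ s, HasDerivAt (fun s => f (K, L * Real.exp (ρ * (t - s)), s)) 0 s := by
    intro s
    set y := L * Real.exp (ρ * (t - s)) with hy
    have hF := (hf (K, y, s)).hasFDerivAt
    have hL : HasDerivAt (fun z => f (K, z, s)) (fderiv ℝ f (K, y, s) (0, 1, 0)) y :=
      hF.comp_hasDerivAt y
        ((hasDerivAt_const y K).prodMk ((hasDerivAt_id y).prodMk (hasDerivAt_const y s)))
    have ht : HasDerivAt (fun r => f (K, y, r)) (fderiv ℝ f (K, y, s) (0, 0, 1)) s :=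
      hF.comp_hasDerivAt s
        ((hasDerivAt_const s K).prodMk ((hasDerivAt_const s y).prodMk (hasDerivAt_id s)))
    have hcurve : HasDerivAt (fun r => L * Real.exp (ρ * (t - r))) (-(ρ * y)) s := by
      refine (((((hasDerivAt_id s).const_sub t).const_mul ρ).exp).const_mul L).congr_deriv ?_
      simp only [hy, id]
      ring
    have h : HasDerivAt (fun r => f (K, L * Real.exp (ρ * (t - r)), r))
        (fderiv ℝ f (K, y, s) (0, -(ρ * y), 1)) s :=
      hF.comp_hasDerivAt s
        ((hasDerivAt_const s K).prodMk (hcurve.prodMk (hasDerivAt_id s)))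
    have hpde' := hpde K y s
    rw [ht.deriv, hL.deriv] at hpde'
    convert h using 1
    have hv : ((0, -(ρ * y), 1) : ℝ × ℝ × ℝ) = (-(ρ * y)) • (0, 1, 0) + (0, 0, 1) := by
      simp
    rw [hv, map_add, map_smul, hpde', smul_eq_mul]
    ring
  have hconst := is_const_of_deriv_eq_zero (fun s => (hchar s).differentiableAt)
    (fun s => (hchar s).deriv) t 0
  simpa [mul_comm] using hconst
end

section
/- Let f : ℝ × ℝ × ℝ → ℝ be differentiable, let ρ be a constant, and suppose ∂₃f(K, L, t) = ρ·L·∂₂f(K, L, t) for all K, L, t. Suppose further that f(·, ·, 0) is positively homogeneous of degree 1, i.e. f(cK, cL, 0) = c·f(K, L, 0) for all c > 0 and K, L > 0. Then there exists F : ℝ × ℝ → ℝ, positively homogeneous of degree 1 on the positive quadrant, such that f(K, L, t) = F(K, L·exp(ρ·t)) for all K, L > 0 and all t. -/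
/-- A solution of the advective equation is constant along the characteristic curves
`s ↦ (K, L * exp (ρ * (t - s)), s)`. -/
theorem hasDerivAt_along_characteristic
    {f : ℝ × ℝ × ℝ → ℝ} (hf : Differentiable ℝ f) {ρ : ℝ}
    (hpde : ∀ K L t : ℝ, deriv (fun s => f (K, L, s)) t
        = ρ * L * deriv (fun y => f (K, y, t)) L) (K L t s : ℝ) :
    HasDerivAt (fun s => f (K, L * Real.exp (ρ * (t - s)), s)) 0 s := by
  set M := L * Real.exp (ρ * (t - s)) with hM
  have hfd := (hf (K, M, s)).hasFDerivAt
  have htime : deriv (fun r => f (K, M, r)) s = fderiv ℝ f (K, M, s) (0, 0, 1) :=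
    (hfd.comp_hasDerivAt s ((hasDerivAt_const s K).prodMk
      ((hasDerivAt_const s M).prodMk (hasDerivAt_id s)))).deriv
  have hlabor : deriv (fun y => f (K, y, s)) M = fderiv ℝ f (K, M, s) (0, 1, 0) :=
    (hfd.comp_hasDerivAt M ((hasDerivAt_const M K).prodMk
      ((hasDerivAt_id M).prodMk (hasDerivAt_const M s)))).deriv
  have hexp : HasDerivAt (fun r => L * Real.exp (ρ * (t - r))) (-(ρ * M)) s := by
    have h := ((((hasDerivAt_id s).const_sub t).const_mul ρ).exp).const_mul L
    refine h.congr_deriv ?_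
    simp only [hM, id_eq]
    ring
  have hcurve := hfd.comp_hasDerivAt s ((hasDerivAt_const s K).prodMk
    (hexp.prodMk (hasDerivAt_id s)))
  refine hcurve.congr_deriv ?_
  have hsplit : ((0 : ℝ), -(ρ * M), (1 : ℝ))
      = -(ρ * M) • ((0 : ℝ), (1 : ℝ), (0 : ℝ)) + ((0 : ℝ), (0 : ℝ), (1 : ℝ)) := by
    simp
  rw [hsplit, map_add, map_smul, ← htime, ← hlabor, hpde K M s, smul_eq_mul]
  ring


/-- Uzawa's Corollary: a CRS production function satisfying the steady-state
advective equation f_t = ρ·L·f_L has the Harrod neutral form F(K, L·exp(ρ·t))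
with F homogeneous of degree 1 on the positive quadrant. -/
theorem uzawa_corollary
    (f : ℝ × ℝ × ℝ → ℝ) (hf : Differentiable ℝ f) (ρ : ℝ)
    (hpde : ∀ K L t : ℝ, deriv (fun s => f (K, L, s)) t
        = ρ * L * deriv (fun y => f (K, y, t)) L)
    (hhom : ∀ c > (0:ℝ), ∀ K L : ℝ, 0 < K → 0 < L →
      f (c * K, c * L, 0) = c * f (K, L, 0)) :
    ∃ F : ℝ × ℝ → ℝ,
      (∀ c > (0:ℝ), ∀ K L : ℝ, 0 < K → 0 < L → F (c * K, c * L) = c * F (K, L)) ∧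
      (∀ K L : ℝ, 0 < K → 0 < L → ∀ t : ℝ, f (K, L, t) = F (K, L * Real.exp (ρ * t))) := by
  refine ⟨fun p => f (p.1, p.2, 0), hhom, fun K L _ _ t => ?_⟩
  have hderiv := hasDerivAt_along_characteristic hf hpde K L t
  simpa using is_const_of_deriv_eq_zero (fun s => (hderiv s).differentiableAt)
    (fun s => (hderiv s).deriv) t 0
end
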